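/- Let x, y ∈ ℝⁿ and let 1 ≤ r, p, q ≤ ∞ with 1/r = 1/p + 1/q. With the uniform probability measure on {1,…,n} defining the ℓ^p-norms ‖z‖_p = (n^{−1} Σ_i |z_i|^p)^{1/p} and the matrix Θ_x as above, one has ‖Θ_x (y − E y·𝟙)‖_r ≤ ‖x‖_p ‖y − E y·𝟙‖_q. -/

import Mathlib

open Finset MeasureTheory
open scoped ENNReal

/-- The matrix `Θ_x`: off-diagonal entries `(x_i + x_j)/(2n)`, diagonal entries
chosen so that all row sums vanish. -/
noncomputable def Theta {n : ℕ} (x : Fin n → ℝ) : Matrix (Fin n) (Fin n) ℝ :=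
  Matrix.of fun i j =>
    if i = j then -∑ l ∈ Finset.univ.erase i, (x i + x l) / (2 * n)
    else (x i + x j) / (2 * n)

/-- The uniform probability measure on `{1,…,n}`. -/
noncomputable def unifMeasure (n : ℕ) : Measure (Fin n) :=
  ((n : ℝ≥0∞)⁻¹) • Measure.count

theorem lintegral_uniform_rpow_enorm {α : Type*} [Fintype α] [MeasurableSpace α]
    [MeasurableSingletonClass α] {N : ℕ} (hN : 0 < N) (f : α → ℝ) {s : ℝ} (hs : 0 ≤ s) :
    ∫⁻ i, ‖f i‖ₑ ^ s ∂((N : ℝ≥0∞)⁻¹ • Measure.count) =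
      ENNReal.ofReal ((N : ℝ)⁻¹ * ∑ i, |f i| ^ s) := by
  rw [lintegral_smul_measure, lintegral_count, tsum_fintype,
    ENNReal.ofReal_mul (by positivity),
    ENNReal.ofReal_sum_of_nonneg (fun i _ => by positivity),
    ENNReal.ofReal_inv_of_pos (by exact_mod_cast hN), ENNReal.ofReal_natCast, smul_eq_mul]
  congr 1
  refine Finset.sum_congr rfl fun i _ => ?_
  rw [← ENNReal.ofReal_rpow_of_nonneg (abs_nonneg _) hs, ← Real.norm_eq_abs, ofReal_norm]

/-- Comparison of `L^r` norms for uniform probability measures on finite types, from the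
comparison of suprema and of power sums. -/
theorem eLpNorm_uniform_le_of_sum_rpow_le {α β : Type*} [Fintype α] [Fintype β]
    [MeasurableSpace α] [MeasurableSpace β] [MeasurableSingletonClass α]
    [MeasurableSingletonClass β] {N M : ℕ} (hN : 0 < N) (hM : 0 < M)
    (f : α → ℝ) (g : β → ℝ) {r : ℝ≥0∞} (hr : 1 ≤ r)
    (hsup : ∀ i, ∃ j, |f i| ≤ |g j|)
    (hsum : ∀ s : ℝ, 1 ≤ s →
      (N : ℝ)⁻¹ * ∑ i, |f i| ^ s ≤ (M : ℝ)⁻¹ * ∑ j, |g j| ^ s) :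
    eLpNorm f r ((N : ℝ≥0∞)⁻¹ • Measure.count) ≤
      eLpNorm g r ((M : ℝ≥0∞)⁻¹ • Measure.count) := by
  rcases eq_or_ne r ∞ with rfl | hr'
  · have hN' : (N : ℝ≥0∞)⁻¹ ≠ 0 := ENNReal.inv_ne_zero.2 (ENNReal.natCast_ne_top N)
    have hM' : (M : ℝ≥0∞)⁻¹ ≠ 0 := ENNReal.inv_ne_zero.2 (ENNReal.natCast_ne_top M)
    simp only [eLpNorm_exponent_top]
    rw [eLpNormEssSup_ennreal_smul_measure hN', eLpNormEssSup_ennreal_smul_measure hM']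
    rw [eLpNormEssSup_count, eLpNormEssSup_count]
    refine iSup_le fun i => ?_
    obtain ⟨j, hj⟩ := hsup i
    refine le_trans ?_ (le_iSup (fun j => ‖g j‖ₑ) j)
    simpa [← ofReal_norm] using ENNReal.ofReal_le_ofReal hj
  · have h0 : r ≠ 0 := (zero_lt_one.trans_le hr).ne'
    have hs : 1 ≤ r.toReal := by
      simpa using ENNReal.toReal_mono hr' hr
    rw [eLpNorm_eq_lintegral_rpow_enorm_toReal h0 hr',
      eLpNorm_eq_lintegral_rpow_enorm_toReal h0 hr',
      lintegral_uniform_rpow_enorm hN _ (by linarith),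
      lintegral_uniform_rpow_enorm hM _ (by linarith)]
    exact ENNReal.rpow_le_rpow (ENNReal.ofReal_le_ofReal (hsum _ hs)) (by positivity)

/-- Two-term weak majorization for powers. -/
theorem rpow_add_rpow_le_of_weak_majorization {A B C D s : ℝ} (hs : 1 ≤ s) (hA : 0 ≤ A)
    (hB : 0 ≤ B) (hD : 0 ≤ D) (hAC : A ≤ C) (hBC : B ≤ C) (hsum : A + B ≤ C + D) :
    A ^ s + B ^ s ≤ C ^ s + D ^ s := by
  have hs0 : 0 ≤ s := by linarith
  rcases le_or_gt B D with hBD | hBD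
  · exact add_le_add (Real.rpow_le_rpow hA hAC hs0) (Real.rpow_le_rpow hB hBD hs0)
  have hDC : 0 < C - D := by linarith
  have hA' : A ^ s ≤ (C + D - B) ^ s := Real.rpow_le_rpow hA (by linarith) hs0
  have hconv := (convexOn_rpow hs).2
  have hC : C ∈ Set.Ici (0 : ℝ) := by simp only [Set.mem_Ici]; linarith
  have ht : 0 ≤ (B - D) / (C - D) := div_nonneg (by linarith) hDC.le
  have ht' : 0 ≤ (C - B) / (C - D) := div_nonneg (by linarith) hDC.le
  have hadd : (B - D) / (C - D) + (C - B) / (C - D) = 1 := by field_simp; ring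
  have h₁ := hconv hC (Set.mem_Ici.2 hD) ht ht' hadd
  have h₂ := hconv hC (Set.mem_Ici.2 hD) ht' ht (by linarith)
  simp only [smul_eq_mul] at h₁ h₂
  have e₁ : (B - D) / (C - D) * C + (C - B) / (C - D) * D = B := by field_simp; ring
  have e₂ : (C - B) / (C - D) * C + (B - D) / (C - D) * D = C + D - B := by field_simp; ring
  rw [e₁] at h₁
  rw [e₂] at h₂
  have e₃ : (B - D) / (C - D) * C ^ s + (C - B) / (C - D) * D ^ s +
      ((C - B) / (C - D) * C ^ s + (B - D) / (C - D) * D ^ s) = C ^ s + D ^ s := by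
    linear_combination (C ^ s + D ^ s) * hadd
  linarith

/-- For `z` with mean zero, `-Θ_x z` is an average of a bilinear expression over pairs of points. -/
theorem Theta_mulVec_eq_neg_average {n : ℕ} (hn : 0 < n) (x z : Fin n → ℝ) (hz : ∑ j, z j = 0)
    (i : Fin n) :
    (Theta x).mulVec z i =
      -∑ j, (n : ℝ)⁻¹ * ((x i * z i + x j * z i + x i * z j - x j * z j) / 2) := by
  have hn' : (n : ℝ) ≠ 0 := by positivity
  have hdiag : ∑ l ∈ univ.erase i, (x i + x l) / (2 * n) =
      ∑ l, (x i + x l) / (2 * n) - (x i + x i) / (2 * n) := by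
    rw [← Finset.add_sum_erase _ _ (mem_univ i)]; ring
  have hentry : ∀ j, Theta x i j * z j = (x i + x j) / (2 * n) * z j -
      if i = j then (∑ l, (x i + x l) / (2 * n)) * z i else 0 := by
    intro j
    simp only [Theta, Matrix.of_apply]
    split_ifs with h
    · subst h; rw [hdiag]; ring
    · ring
  have hzero : ∑ j, x i * z j / n = 0 := by
    rw [← Finset.sum_div, ← Finset.mul_sum, hz]; simp
  simp only [Matrix.mulVec, dotProduct, hentry]
  rw [Finset.sum_sub_distrib, Finset.sum_ite_eq, if_pos (mem_univ i), Finset.sum_mul,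
    ← Finset.sum_sub_distrib, ← Finset.sum_neg_distrib]
  rw [← sub_eq_zero, ← Finset.sum_sub_distrib, ← hzero]
  refine Finset.sum_congr rfl fun j _ => ?_
  field_simp
  ring

/-- The larger of `|x i|`, `|x j|` above the diagonal and the smaller one below it. -/
noncomputable def pairSort {n : ℕ} (x : Fin n → ℝ) (ij : Fin n × Fin n) : ℝ :=
  if ij.1 ≤ ij.2 then max |x ij.1| |x ij.2| else min |x ij.1| |x ij.2|

theorem sum_prod_symmetrize {n : ℕ} (F : Fin n × Fin n → ℝ) :
    2 * ∑ ij, F ij = ∑ ij : Fin n × Fin n, (F ij + F ij.swap) := by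
  rw [Finset.sum_add_distrib, two_mul]
  congr 1
  exact (Equiv.sum_comp (Equiv.prodComm (Fin n) (Fin n)) F).symm

theorem eLpNorm_pairSort_le {n : ℕ} (hn : 0 < n) (x : Fin n → ℝ) {p : ℝ≥0∞} (hp : 1 ≤ p) :
    eLpNorm (pairSort x) p (((n * n : ℕ) : ℝ≥0∞)⁻¹ • Measure.count) ≤
      eLpNorm x p (unifMeasure n) := by
  refine eLpNorm_uniform_le_of_sum_rpow_le (by positivity) hn _ _ hp ?_ ?_
  · rintro ⟨i, j⟩
    unfold pairSort
    split_ifs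
    · rcases max_choice |x i| |x j| with h | h <;> rw [h]
      exacts [⟨i, by simp⟩, ⟨j, by simp⟩]
    · rcases min_choice |x i| |x j| with h | h <;> rw [h]
      exacts [⟨i, by simp⟩, ⟨j, by simp⟩]
  · intro s _
    have hpair : ∀ ij : Fin n × Fin n, |pairSort x ij| ^ s + |pairSort x ij.swap| ^ s =
        |x ij.1| ^ s + |x ij.2| ^ s := by
      rintro ⟨i, j⟩
      simp only [pairSort, Prod.swap, max_comm |x j|, min_comm |x j|]
      rcases lt_trichotomy i j with h | h | h
      · rcases le_total |x i| |x j| with h' | h' <;> simp [h.le, h.not_ge, h', add_comm]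
      · subst h; simp
      · rcases le_total |x i| |x j| with h' | h' <;> simp [h.le, h.not_ge, h', add_comm]
    have h2 := sum_prod_symmetrize fun ij => |pairSort x ij| ^ s
    simp only [hpair] at h2
    simp only [Fintype.sum_prod_type (fun ij : Fin n × Fin n => |x ij.1| ^ s + |x ij.2| ^ s),
      Finset.sum_add_distrib, sum_const, card_univ, Fintype.card_fin, nsmul_eq_mul,
      ← Finset.mul_sum] at h2
    have h3 : ∑ ij, |pairSort x ij| ^ s = n * ∑ i, |x i| ^ s := by linarith
    rw [h3]
    have hn' : (n : ℝ) ≠ 0 := by positivity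
    push_cast
    apply le_of_eq
    field_simp

theorem abs_mul_add_mul_le_sorted (a b c d : ℝ) :
    |a * c| + |b * d| ≤ max |a| |b| * max |c| |d| + min |a| |b| * min |c| |d| ∧
    |a * d| + |b * c| ≤ max |a| |b| * max |c| |d| + min |a| |b| * min |c| |d| := by
  simp only [abs_mul]
  rcases le_total |a| |b| with h | h <;> rcases le_total |c| |d| with h' | h' <;>
    simp only [max_eq_left, max_eq_right, min_eq_left, min_eq_right, h, h'] <;>
    constructor <;> nlinarith [mul_nonneg (sub_nonneg.2 h) (sub_nonneg.2 h')]

theorem abs_pair_form_le (a b c d : ℝ) :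
    |(a * c + b * c + a * d - b * d) / 2| ≤ max |a| |b| * max |c| |d| := by
  have hM : 0 ≤ max |a| |b| := (abs_nonneg a).trans (le_max_left _ _)
  have h₁ : |a * (c + d)| ≤ max |a| |b| * |c + d| := by
    rw [abs_mul]; exact mul_le_mul_of_nonneg_right (le_max_left _ _) (abs_nonneg _)
  have h₂ : |b * (c - d)| ≤ max |a| |b| * |c - d| := by
    rw [abs_mul]; exact mul_le_mul_of_nonneg_right (le_max_right _ _) (abs_nonneg _)
  have h₃ : |c + d| + |c - d| ≤ 2 * max |c| |d| := by
    have hc := le_max_left |c| |d|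
    have hd := le_max_right |c| |d|
    rw [abs_le] at hc hd
    rcases abs_cases (c + d) with h | h <;> rcases abs_cases (c - d) with h' | h' <;> linarith
  have h₄ := mul_le_mul_of_nonneg_left h₃ hM
  rw [abs_le] at h₁ h₂ ⊢
  constructor <;> linarith

theorem abs_pair_form_add_le (a b c d : ℝ) :
    |(a * c + b * c + a * d - b * d) / 2| + |(b * d + a * d + b * c - a * c) / 2| ≤
      max |a| |b| * max |c| |d| + min |a| |b| * min |c| |d| := by
  obtain ⟨h₁, h₂⟩ := abs_mul_add_mul_le_sorted a b c d
  have h₃ := abs_sub (a * c) (b * d)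
  have h₄ := abs_add_le (a * d) (b * c)
  have h₅ := h₃.trans h₁
  have h₆ := h₄.trans h₂
  rw [abs_le] at h₅ h₆
  rcases abs_cases ((a * c + b * c + a * d - b * d) / 2) with h | h <;>
    rcases abs_cases ((b * d + a * d + b * c - a * c) / 2) with h' | h' <;> linarith

theorem eLpNorm_pair_form_le {n : ℕ} (hn : 0 < n) (x z : Fin n → ℝ) {r : ℝ≥0∞} (hr : 1 ≤ r) :
    eLpNorm (fun ij : Fin n × Fin n =>
        (x ij.1 * z ij.1 + x ij.2 * z ij.1 + x ij.1 * z ij.2 - x ij.2 * z ij.2) / 2) r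
        (((n * n : ℕ) : ℝ≥0∞)⁻¹ • Measure.count) ≤
      eLpNorm (fun ij => pairSort x ij * pairSort z ij) r
        (((n * n : ℕ) : ℝ≥0∞)⁻¹ • Measure.count) := by
  have hmax (i j : Fin n) : 0 ≤ max |x i| |x j| * max |z i| |z j| := by positivity
  have hmin (i j : Fin n) : 0 ≤ min |x i| |x j| * min |z i| |z j| := by positivity
  have hle (i j : Fin n) := abs_pair_form_le (x i) (x j) (z i) (z j)
  refine eLpNorm_uniform_le_of_sum_rpow_le (by positivity) (by positivity) _ _ hr ?_ ?_
  · rintro ⟨i, j⟩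
    rcases le_total i j with h | h
    · exact ⟨(i, j), by simpa only [pairSort, h, if_true, abs_of_nonneg (hmax i j)] using hle i j⟩
    · refine ⟨(j, i), ?_⟩
      simp only [pairSort, h, if_true, abs_of_nonneg (hmax j i)]
      simpa only [max_comm] using hle i j
  · intro s hs
    refine mul_le_mul_of_nonneg_left ?_ (by positivity)
    refine le_of_mul_le_mul_left ?_ (zero_lt_two (α := ℝ))
    rw [sum_prod_symmetrize, sum_prod_symmetrize]
    have hupper (i j : Fin n) (h : i < j) :
        |(x i * z i + x j * z i + x i * z j - x j * z j) / 2| ^ s +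
          |(x j * z j + x i * z j + x j * z i - x i * z i) / 2| ^ s ≤
        |pairSort x (i, j) * pairSort z (i, j)| ^ s +
          |pairSort x (j, i) * pairSort z (j, i)| ^ s := by
      simp only [pairSort, h.le, h.not_ge, if_true, if_false, abs_of_nonneg (hmax i j),
        abs_of_nonneg (hmin j i)]
      have hji := hle j i
      have hadd := abs_pair_form_add_le (x i) (x j) (z i) (z j)
      rw [max_comm |x j|, max_comm |z j|] at hji
      rw [min_comm |x j|, min_comm |z j|]
      exact rpow_add_rpow_le_of_weak_majorization hs (abs_nonneg _) (abs_nonneg _) (hmin i j)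
        (hle i j) hji hadd
    refine Finset.sum_le_sum fun ⟨i, j⟩ _ => ?_
    rcases lt_trichotomy i j with h | h | h
    · exact hupper i j h
    · subst h
      simp only [pairSort, Prod.swap, le_refl, if_true, max_self]
      have e : (x i * z i + x i * z i + x i * z i - x i * z i) / 2 = x i * z i := by ring
      rw [e, ← abs_mul, abs_abs]
    · have := hupper j i h
      simp only [Prod.swap]
      linarith

theorem eLpNorm_Theta_mulVec_le {n : ℕ} (hn : 0 < n) (x z : Fin n → ℝ) (hz : ∑ j, z j = 0)
    {r : ℝ≥0∞} (hr : 1 ≤ r) :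
    eLpNorm ((Theta x).mulVec z) r (unifMeasure n) ≤
      eLpNorm (fun ij : Fin n × Fin n =>
        (x ij.1 * z ij.1 + x ij.2 * z ij.1 + x ij.1 * z ij.2 - x ij.2 * z ij.2) / 2) r
        (((n * n : ℕ) : ℝ≥0∞)⁻¹ • Measure.count) := by
  have hn' : (n : ℝ) ≠ 0 := by positivity
  have hw : ∑ _j : Fin n, (n : ℝ)⁻¹ = 1 := by simp [hn']
  have habs (i : Fin n) : |(Theta x).mulVec z i| ≤
      ∑ j, (n : ℝ)⁻¹ * |(x i * z i + x j * z i + x i * z j - x j * z j) / 2| := by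
    rw [Theta_mulVec_eq_neg_average hn x z hz, abs_neg]
    refine (Finset.abs_sum_le_sum_abs _ _).trans_eq (Finset.sum_congr rfl fun j _ => ?_)
    rw [abs_mul, abs_of_nonneg (by positivity : (0 : ℝ) ≤ (n : ℝ)⁻¹)]
  refine eLpNorm_uniform_le_of_sum_rpow_le hn (by positivity) _ _ hr ?_ ?_
  · intro i
    by_contra! hlt
    refine (habs i).not_gt ?_
    calc _ < ∑ _j : Fin n, (n : ℝ)⁻¹ * |(Theta x).mulVec z i| :=
          Finset.sum_lt_sum_of_nonempty ⟨i, mem_univ i⟩ fun j _ =>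
            mul_lt_mul_of_pos_left (hlt (i, j)) (by positivity)
      _ = |(Theta x).mulVec z i| := by rw [← Finset.sum_mul, hw, one_mul]
  · intro s hs
    rw [Fintype.sum_prod_type]
    push_cast
    rw [mul_inv, mul_assoc]
    refine mul_le_mul_of_nonneg_left ?_ (by positivity)
    rw [Finset.mul_sum]
    refine Finset.sum_le_sum fun i _ => ?_
    rw [Finset.mul_sum]
    exact (Real.rpow_le_rpow (abs_nonneg _) (habs i) (by linarith)).trans
      (Real.rpow_arith_mean_le_arith_mean_rpow _ _ _ (fun _ _ => by positivity) hw
        (fun _ _ => abs_nonneg _) hs)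

/-- (3.4): the Hölder-type inequality `‖Θ_x (y − Ey·𝟙)‖_r ≤ ‖x‖_p ‖y − Ey·𝟙‖_q`
for the `ℓ^p`-norms of the uniform probability measure on `n` points. -/
theorem theta_holder_inequality {n : ℕ} (hn : 0 < n) (x y : Fin n → ℝ)
    (r p q : ℝ≥0∞) (hr : 1 ≤ r) (hp : 1 ≤ p) (hq : 1 ≤ q)
    (hpq : 1 / r = 1 / p + 1 / q) :
    eLpNorm ((Theta x).mulVec (fun i => y i - (n : ℝ)⁻¹ * ∑ j, y j)) r
        (unifMeasure n) ≤
      eLpNorm x p (unifMeasure n) *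
        eLpNorm (fun i => y i - (n : ℝ)⁻¹ * ∑ j, y j) q (unifMeasure n) := by
  have hn' : (n : ℝ) ≠ 0 := by positivity
  set z : Fin n → ℝ := fun i => y i - (n : ℝ)⁻¹ * ∑ j, y j with hzdef
  have hz : ∑ j, z j = 0 := by
    simp [hzdef, Finset.sum_sub_distrib, hn']
  have : ENNReal.HolderTriple p q r := ⟨by simpa [one_div] using hpq.symm⟩
  calc _ ≤ _ := eLpNorm_Theta_mulVec_le hn x z hz hr
    _ ≤ _ := eLpNorm_pair_form_le hn x z hr
    _ ≤ eLpNorm (pairSort x) p (((n * n : ℕ) : ℝ≥0∞)⁻¹ • Measure.count) *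
        eLpNorm (pairSort z) q (((n * n : ℕ) : ℝ≥0∞)⁻¹ • Measure.count) :=
      eLpNorm_smul_le_mul_eLpNorm (f := pairSort z) (φ := pairSort x)
        (measurable_of_finite _).aestronglyMeasurable (measurable_of_finite _).aestronglyMeasurable
    _ ≤ _ := mul_le_mul' (eLpNorm_pairSort_le hn x hp) (eLpNorm_pairSort_le hn z hq)
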